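/- Assume (H1) and (H3), and assume h'(σ1) ≠ 0 for some σ1 ∈ (0, r0²). Let κ̃ = sup_{σ∈(0,r0²]} (−1/(2σ h'(σ)²)) < 0. For κ > κ̃ define Q(κ) = −8r0³/(3√F(0)) + ∫_0^{r0} ((r² − r0²)²/r²)·( √((1 + 2κ r² h'(r²)²)/F(r²)) − 1/√F(0) ) dr. Then: (i) for every κ > κ̃ the integrand is integrable on (0, r0), so Q(κ) is well defined; (ii) Q is strictly increasing on (κ̃, ∞); and (iii) Q(κ) → +∞ as κ → +∞. -/

import Mathlib

open MeasureTheory Filter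

noncomputable section

/-- `Fnl f r0 σ = ∫_σ^{r0²} f(w) dw`. -/
def Fnl (f : ℝ → ℝ) (r0 : ℝ) (σ : ℝ) : ℝ := ∫ w in σ..(r0 ^ 2), f w

open Set Topology Asymptotics

lemma Fnl_hasDerivAt {f : ℝ → ℝ} (hf : Continuous f) (r0 σ : ℝ) :
    HasDerivAt (Fnl f r0) (-f σ) σ :=
  intervalIntegral.integral_hasDerivAt_left (hf.intervalIntegrable _ _)
    hf.stronglyMeasurable.stronglyMeasurableAtFilter hf.continuousAt

/-- A continuous function is integrable on a bounded open interval as soon as it is bounded near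
both endpoints. -/
lemma integrableOn_Ioo_of_continuousOn_of_isBigO_one {g : ℝ → ℝ} {a b : ℝ} (hab : a < b)
    (hg : ContinuousOn g (Ioo a b)) (ha : g =O[𝓝[>] a] fun _ => (1 : ℝ))
    (hb : g =O[𝓝[<] b] fun _ => (1 : ℝ)) : IntegrableOn g (Ioo a b) := by
  obtain ⟨A, hA⟩ := ha.bound
  obtain ⟨B, hB⟩ := hb.bound
  obtain ⟨a', ha', hA'⟩ := (mem_nhdsGT_iff_exists_Ioo_subset' hab).1 (hA.and (Ioo_mem_nhdsGT hab))
  obtain ⟨b', hb', hB'⟩ := (mem_nhdsLT_iff_exists_Ioo_subset' hab).1 (hB.and (Ioo_mem_nhdsLT hab))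
  obtain ⟨p, hap, hp⟩ := exists_between (lt_min (mem_Ioi.1 ha') hab)
  obtain ⟨q, hq, hqb⟩ := exists_between (max_lt (mem_Iio.1 hb') hab)
  rw [lt_min_iff] at hp
  rw [max_lt_iff] at hq
  have h1 : IntegrableOn g (Ioo a p) :=
    IntegrableOn.of_bound (C := A) measure_Ioo_lt_top
      ((hg.mono (Ioo_subset_Ioo_right hp.2.le)).aestronglyMeasurable measurableSet_Ioo)
      ((ae_restrict_iff' measurableSet_Ioo).2 (.of_forall fun x hx => by
        simpa using (hA' ⟨hx.1, hx.2.trans hp.1⟩).1))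
  have h2 : IntegrableOn g (Ioo q b) :=
    IntegrableOn.of_bound (C := B) measure_Ioo_lt_top
      ((hg.mono (Ioo_subset_Ioo_left hq.2.le)).aestronglyMeasurable measurableSet_Ioo)
      ((ae_restrict_iff' measurableSet_Ioo).2 (.of_forall fun x hx => by
        simpa using (hB' ⟨hq.1.trans hx.1, hx.2⟩).1))
  have h3 : IntegrableOn g (Icc p q) :=
    (hg.mono (Icc_subset_Ioo hap hqb)).integrableOn_Icc
  refine ((h1.union h3).union h2).mono_set fun x hx => ?_
  rcases lt_or_ge x p with hxp | hxp
  · exact .inl (.inl ⟨hx.1, hxp⟩)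
  rcases le_or_gt x q with hxq | hxq
  · exact .inl (.inr ⟨hxp, hxq⟩)
  · exact .inr ⟨hxq, hx.2⟩

lemma exists_mul_sq_le_integral {f : ℝ → ℝ} {f' R : ℝ} (hf : Continuous f) (hR : f R = 0)
    (hd : HasDerivAt f f' R) (hf' : f' < 0) :
    ∃ c > 0, ∀ᶠ s in 𝓝[<] R, c * (R - s) ^ 2 ≤ ∫ w in s..R, f w := by
  have hev : ∀ᶠ w in 𝓝[<] R, slope f R w < f' / 2 :=
    (hasDerivAt_iff_tendsto_slope.1 hd |>.mono_left (nhdsLT_le_nhdsNE R)).eventually_lt_const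
      (by linarith)
  obtain ⟨l, hl, hlR⟩ := (mem_nhdsLT_iff_exists_Ioo_subset).1 hev
  refine ⟨-f' / 4, by linarith, ?_⟩
  filter_upwards [Ioo_mem_nhdsLT hl] with s hs
  have hint : ∫ w in s..R, (-f' / 2) * (R - w) = -f' / 4 * (R - s) ^ 2 := by
    rw [intervalIntegral.integral_const_mul, intervalIntegral.integral_comp_sub_left (fun x => x) R,
      integral_id]
    ring
  rw [← hint]
  refine intervalIntegral.integral_mono_on hs.2.le
    (Continuous.intervalIntegrable (by fun_prop) _ _) (hf.intervalIntegrable _ _) fun w hw => ?_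
  rcases hw.2.eq_or_lt with rfl | hwR
  · simp [hR]
  · have := hlR (⟨hs.1.trans_le hw.1, hwR⟩ : w ∈ Ioo l R)
    simp only [mem_ofPred_eq, slope_def_field, hR, sub_zero] at this
    rw [div_lt_iff_of_neg (by linarith)] at this
    linarith

/-- For `t ≥ 1`, the increment of `t ↦ √(1 + t² a)` from `t = 0` dominates `t` times its value
at `t = 1`. -/
lemma mul_sqrt_one_add_sub_one_le {a t : ℝ} (ha : 0 ≤ a) (ht : 1 ≤ t) :
    t * (√(1 + a) - 1) ≤ √(1 + t ^ 2 * a) - 1 := by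
  have h1 : 1 ≤ √(1 + a) := Real.one_le_sqrt.2 (by linarith)
  have h2 : √(1 + a) ^ 2 = 1 + a := Real.sq_sqrt (by linarith)
  have : 1 + t * (√(1 + a) - 1) ≤ √(1 + t ^ 2 * a) := by
    apply Real.le_sqrt_of_sq_le
    have ha' : a = √(1 + a) ^ 2 - 1 := by linarith
    generalize √(1 + a) = s at *
    subst ha'
    nlinarith [mul_nonneg (mul_nonneg (zero_le_one.trans ht) (sub_nonneg.2 ht)) (sub_nonneg.2 h1)]
  linarith

/-- The integrand of the Vakhitov–Kolokolov quantity, with `k` in the role of the derivative of `h`. -/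
def vkIntegrand (f k : ℝ → ℝ) (r0 κ r : ℝ) : ℝ :=
  ((r ^ 2 - r0 ^ 2) ^ 2 / r ^ 2) *
    (√((1 + 2 * κ * r ^ 2 * (k (r ^ 2)) ^ 2) / Fnl f r0 (r ^ 2)) - 1 / √(Fnl f r0 0))

section

variable {f k : ℝ → ℝ} {r0 : ℝ}

lemma tendsto_sq_nhdsLT (hr0 : 0 < r0) :
    Tendsto (fun r : ℝ => r ^ 2) (𝓝[<] r0) (𝓝[<] (r0 ^ 2)) := by
  refine tendsto_nhdsWithin_iff.2
    ⟨((continuous_pow 2).tendsto r0).mono_left nhdsWithin_le_nhds, ?_⟩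
  filter_upwards [Ioo_mem_nhdsLT hr0] with r hr
  exact pow_lt_pow_left₀ hr.2 hr.1.le two_ne_zero

lemma vkIntegrand_isBigO_one_left (hf : Continuous f) (hk : Differentiable ℝ k)
    (hF0 : 0 < Fnl f r0 0) (κ : ℝ) :
    vkIntegrand f k r0 κ =O[𝓝[>] 0] fun _ => (1 : ℝ) := by
  set φ : ℝ → ℝ := fun s => √((1 + 2 * κ * s * (k s) ^ 2) / Fnl f r0 s) with hφ
  have hφd : DifferentiableAt ℝ φ 0 := by
    have hF := (Fnl_hasDerivAt hf r0 0).differentiableAt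
    have hk0 := hk 0
    refine DifferentiableAt.sqrt (DifferentiableAt.div (by fun_prop) hF hF0.ne') ?_
    simpa using hF0.ne'
  have hsq : Tendsto (fun r : ℝ => r ^ 2) (𝓝[>] 0) (𝓝 0) := by
    simpa using ((continuous_pow 2).tendsto (0 : ℝ)).mono_left nhdsWithin_le_nhds
  have h1 : (fun r : ℝ => φ (r ^ 2) - φ 0) =O[𝓝[>] 0] fun r : ℝ => r ^ 2 := by
    simpa [Function.comp_def] using hφd.isBigO_sub.comp_tendsto hsq
  have h2 : (fun r : ℝ => (r ^ 2 - r0 ^ 2) ^ 2 / r ^ 2) =O[𝓝[>] 0] fun r : ℝ => (r ^ 2)⁻¹ := by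
    have : (fun r : ℝ => (r ^ 2 - r0 ^ 2) ^ 2) =O[𝓝[>] 0] fun _ => (1 : ℝ) :=
      ((Continuous.tendsto (by fun_prop) 0).mono_left nhdsWithin_le_nhds).isBigO_one ℝ
    simpa [div_eq_mul_inv] using this.mul (isBigO_refl (fun r : ℝ => (r ^ 2)⁻¹) _)
  refine (h2.mul h1).congr' (.of_forall fun r => ?_) ?_
  · simp [vkIntegrand, hφ]
  · filter_upwards [self_mem_nhdsWithin] with r hr
    have : r ≠ 0 := (mem_Ioi.1 hr).ne'
    field_simp

lemma vkIntegrand_isBigO_one_right (hf : Continuous f) (hk : Continuous k) (hr0 : 0 < r0)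
    (hfr0 : f (r0 ^ 2) = 0) {f' : ℝ} (hd : HasDerivAt f f' (r0 ^ 2)) (hf' : f' < 0) (κ : ℝ) :
    vkIntegrand f k r0 κ =O[𝓝[<] r0] fun _ => (1 : ℝ) := by
  obtain ⟨c, hc, hcev⟩ := exists_mul_sq_le_integral hf hfr0 hd hf'
  have hu : (fun s => (s - r0 ^ 2) * √(1 / Fnl f r0 s)) =O[𝓝[<] (r0 ^ 2)] fun _ => (1 : ℝ) := by
    refine IsBigO.of_bound (√(1 / c)) ?_
    filter_upwards [hcev, self_mem_nhdsWithin] with s hs hsR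
    have hpos : 0 < (s - r0 ^ 2) ^ 2 := by
      have := mem_Iio.1 hsR
      exact sq_pos_of_neg (by linarith)
    have hF : c * (s - r0 ^ 2) ^ 2 ≤ Fnl f r0 s := by
      simpa only [Fnl, sub_sq_comm s] using hs
    rw [norm_mul, Real.norm_eq_abs, Real.norm_of_nonneg (Real.sqrt_nonneg _), ← Real.sqrt_sq_eq_abs,
      ← Real.sqrt_mul (sq_nonneg _), norm_one, mul_one]
    apply Real.sqrt_le_sqrt
    rw [mul_one_div, div_le_div_iff₀ ((mul_pos hc hpos).trans_le hF) hc]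
    linarith
  have hu' : (fun r => (r ^ 2 - r0 ^ 2) * √(1 / Fnl f r0 (r ^ 2))) =O[𝓝[<] r0]
      fun _ => (1 : ℝ) := hu.comp_tendsto (tendsto_sq_nhdsLT hr0)
  have bdd : ∀ {g : ℝ → ℝ}, ContinuousAt g r0 → g =O[𝓝[<] r0] fun _ => (1 : ℝ) := fun hg =>
    (hg.tendsto.mono_left nhdsWithin_le_nhds).isBigO_one ℝ
  have h1 := (bdd (g := fun r => (r ^ 2 - r0 ^ 2) / r ^ 2 *
      √(1 + 2 * κ * r ^ 2 * (k (r ^ 2)) ^ 2)) (by fun_prop (disch := positivity))).mul hu'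
  have h2 := bdd (g := fun r => (r ^ 2 - r0 ^ 2) ^ 2 / r ^ 2 * (1 / √(Fnl f r0 0)))
    (by fun_prop (disch := positivity))
  simp only [mul_one] at h1
  refine (h1.sub h2).congr' ?_ .rfl
  filter_upwards [(tendsto_sq_nhdsLT hr0).eventually hcev] with r hr
  have hF : 0 ≤ 1 / Fnl f r0 (r ^ 2) := one_div_nonneg.2 (le_trans (by positivity) hr)
  rw [vkIntegrand, div_eq_mul_one_div (1 + _), Real.sqrt_mul' _ hF]
  ring

lemma vkIntegrand_integrableOn (hf : Continuous f) (hk : Differentiable ℝ k) (hr0 : 0 < r0)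
    (hfr0 : f (r0 ^ 2) = 0) {f' : ℝ} (hd : HasDerivAt f f' (r0 ^ 2)) (hf' : f' < 0)
    (hF : ∀ σ ∈ Ico (0 : ℝ) (r0 ^ 2), 0 < Fnl f r0 σ) (κ : ℝ) :
    IntegrableOn (vkIntegrand f k r0 κ) (Ioo 0 r0) := by
  refine integrableOn_Ioo_of_continuousOn_of_isBigO_one hr0 (fun r hr => ?_)
    (vkIntegrand_isBigO_one_left hf hk (hF 0 ⟨le_rfl, by positivity⟩) κ)
    (vkIntegrand_isBigO_one_right hf hk.continuous hr0 hfr0 hd hf' κ)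
  have hr2 : Fnl f r0 (r ^ 2) ≠ 0 :=
    (hF _ ⟨sq_nonneg r, pow_lt_pow_left₀ hr.2 hr.1.le two_ne_zero⟩).ne'
  have hr' : r ^ 2 ≠ 0 := pow_ne_zero 2 hr.1.ne'
  have hFc : Continuous (Fnl f r0) :=
    continuous_iff_continuousAt.2 fun σ => (Fnl_hasDerivAt hf r0 σ).continuousAt
  have hkc := hk.continuous
  unfold vkIntegrand
  exact ContinuousAt.continuousWithinAt (by fun_prop (disch := assumption))

lemma vkIntegrand_sub_vkIntegrand (κ₁ κ₂ : ℝ) {r : ℝ} (hF : 0 ≤ Fnl f r0 (r ^ 2)) :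
    vkIntegrand f k r0 κ₂ r - vkIntegrand f k r0 κ₁ r =
      ((r ^ 2 - r0 ^ 2) ^ 2 / r ^ 2 / √(Fnl f r0 (r ^ 2))) *
        (√(1 + 2 * κ₂ * r ^ 2 * (k (r ^ 2)) ^ 2) - √(1 + 2 * κ₁ * r ^ 2 * (k (r ^ 2)) ^ 2)) := by
  simp only [vkIntegrand, Real.sqrt_div' _ hF]
  ring

end

/-- the Vakhitov–Kolokolov quantity
`Q(κ) = P_κ'(0)` is well defined for `κ > κ̃`, strictly increasing in `κ`, and tends
to `+∞` as `κ → +∞`; moreover `κ̃ < 0`.  (The supremum defining `κ̃` is taken over the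
points `σ ∈ (0, r0²]` where `h'(σ) ≠ 0`, the other values being `−∞`.) -/
theorem VK_slope_monotone
    (r0 : ℝ) (hr0 : 0 < r0)
    (f h : ℝ → ℝ) (hf : ContDiff ℝ (⊤ : ℕ∞) f) (hh : ContDiff ℝ (⊤ : ℕ∞) h)
    (hfr0 : f (r0 ^ 2) = 0)
    (hH3 : (∀ σ ∈ Set.Ico (0:ℝ) (r0 ^ 2), 0 < Fnl f r0 σ) ∧
      0 < deriv (deriv (Fnl f r0)) (r0 ^ 2))
    (σ1 : ℝ) (hσ1 : σ1 ∈ Set.Ioo (0:ℝ) (r0 ^ 2)) (hhσ1 : deriv h σ1 ≠ 0)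
    (κtil : ℝ)
    (hκtil : κtil = sSup {y : ℝ | ∃ σ ∈ Set.Ioc (0:ℝ) (r0 ^ 2),
      deriv h σ ≠ 0 ∧ y = -(1 / (2 * σ * (deriv h σ) ^ 2))})
    (Q : ℝ → ℝ)
    (hQ : Q = fun κ : ℝ => -(8 * r0 ^ 3) / (3 * Real.sqrt (Fnl f r0 0)) +
      ∫ r in (0:ℝ)..r0, ((r ^ 2 - r0 ^ 2) ^ 2 / r ^ 2) *
        (Real.sqrt ((1 + 2 * κ * r ^ 2 * (deriv h (r ^ 2)) ^ 2) / Fnl f r0 (r ^ 2)) -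
          1 / Real.sqrt (Fnl f r0 0))) :
    κtil < 0 ∧
    (∀ κ : ℝ, κtil < κ →
      IntegrableOn (fun r : ℝ => ((r ^ 2 - r0 ^ 2) ^ 2 / r ^ 2) *
        (Real.sqrt ((1 + 2 * κ * r ^ 2 * (deriv h (r ^ 2)) ^ 2) / Fnl f r0 (r ^ 2)) -
          1 / Real.sqrt (Fnl f r0 0))) (Set.Ioo 0 r0) volume) ∧
    StrictMonoOn Q (Set.Ioi κtil) ∧
    Tendsto Q atTop atTop := by
  have hfc := hf.continuous
  have hk : Differentiable ℝ (deriv h) :=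
    (contDiff_infty_iff_deriv.1 hh).2.differentiable (by simp)
  obtain ⟨hF, hF2⟩ := hH3
  have hFnn : ∀ r ∈ Ioc 0 r0, 0 ≤ Fnl f r0 (r ^ 2) := by
    intro r hr
    rcases hr.2.eq_or_lt with rfl | hlt
    · simp [Fnl]
    · exact (hF _ ⟨sq_nonneg r, pow_lt_pow_left₀ hlt hr.1.le two_ne_zero⟩).le
  have hd : HasDerivAt f (deriv f (r0 ^ 2)) (r0 ^ 2) :=
    (hf.differentiable (by simp) _).hasDerivAt
  have hf' : deriv f (r0 ^ 2) < 0 := by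
    rw [funext fun σ => (Fnl_hasDerivAt hfc r0 σ).deriv, deriv.fun_neg] at hF2
    linarith
  set S := {y : ℝ | ∃ σ ∈ Set.Ioc (0:ℝ) (r0 ^ 2),
      deriv h σ ≠ 0 ∧ y = -(1 / (2 * σ * (deriv h σ) ^ 2))}
  obtain ⟨M, hM⟩ := isCompact_Icc.exists_bound_of_continuousOn
    (hk.continuous.continuousOn (s := Icc 0 (r0 ^ 2)))
  have hMpos : 0 < M :=
    (norm_pos_iff.2 hhσ1).trans_le (hM σ1 (Ioo_subset_Icc_self hσ1))
  have hSub : ∀ y ∈ S, y ≤ -(1 / (2 * r0 ^ 2 * M ^ 2)) := by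
    rintro y ⟨σ, hσ, hne, rfl⟩
    have hσ0 := hσ.1
    have hMσ : deriv h σ ^ 2 ≤ M ^ 2 :=
      sq_le_sq.2 ((hM σ (Ioc_subset_Icc_self hσ)).trans (le_abs_self M))
    have hσR := hσ.2
    gcongr
  have hκneg : κtil < 0 := by
    rw [hκtil]
    have hSne : S.Nonempty := ⟨_, σ1, Ioo_subset_Ioc_self hσ1, hhσ1, rfl⟩
    refine (csSup_le hSne hSub).trans_lt ?_
    exact neg_neg_of_pos (by positivity)
  have hN : ∀ κ, κtil < κ → ∀ r ∈ Ioc 0 r0, 0 < 1 + 2 * κ * r ^ 2 * (deriv h (r ^ 2)) ^ 2 := by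
    intro κ hκ r hr
    by_cases hne : deriv h (r ^ 2) = 0
    · simp [hne]
    have hr0' := hr.1
    have hle : -(1 / (2 * r ^ 2 * (deriv h (r ^ 2)) ^ 2)) < κ := by
      refine lt_of_le_of_lt ?_ hκ
      rw [hκtil]
      exact le_csSup ⟨_, fun y hy => hSub y hy⟩
        ⟨r ^ 2, ⟨by positivity, pow_le_pow_left₀ hr.1.le hr.2 2⟩, hne, rfl⟩
    have hpos : 0 < 2 * r ^ 2 * (deriv h (r ^ 2)) ^ 2 := by positivity
    rw [← neg_div, div_lt_iff₀ hpos] at hle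
    linarith
  have hint : ∀ κ, IntegrableOn (vkIntegrand f (deriv h) r0 κ) (Ioo 0 r0) :=
    vkIntegrand_integrableOn hfc hk hr0 hfr0 hd hf' hF
  have hintv : ∀ κ, IntervalIntegrable (vkIntegrand f (deriv h) r0 κ) volume 0 r0 := fun κ =>
    (intervalIntegrable_iff_integrableOn_Ioo_of_le hr0.le).2 (hint κ)
  have hQ' : ∀ κ, Q κ = -(8 * r0 ^ 3) / (3 * √(Fnl f r0 0)) +
      ∫ r in (0 : ℝ)..r0, vkIntegrand f (deriv h) r0 κ r := fun κ => by rw [hQ]; rfl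
  have hmono : StrictMonoOn Q (Ioi κtil) := by
    intro κ₁ hκ₁ κ₂ hκ₂ hlt
    rw [hQ', hQ']
    refine add_lt_add_right ?_ _
    refine intervalIntegral.integral_lt_integral_of_ae_le_of_measure_setOfPred_lt_ne_zero hr0.le
      (hintv _) (hintv _) ?_ ?_
    · refine (ae_restrict_iff' measurableSet_Ioc).2 (.of_forall fun r hr => ?_)
      rw [← sub_nonneg, vkIntegrand_sub_vkIntegrand _ _ (hFnn r hr)]
      refine mul_nonneg (by positivity) (sub_nonneg.2 (Real.sqrt_le_sqrt ?_))
      gcongr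
    · have hopen : IsOpen (Ioo 0 r0 ∩ {r | deriv h (r ^ 2) ≠ 0}) :=
        isOpen_Ioo.inter (isOpen_ne_fun (hk.continuous.comp (continuous_pow 2)) continuous_const)
      have hne : (Ioo 0 r0 ∩ {r | deriv h (r ^ 2) ≠ 0}).Nonempty :=
        ⟨√σ1, ⟨Real.sqrt_pos.2 hσ1.1, (Real.sqrt_lt' hr0).2 hσ1.2⟩, by
          simpa [Real.sq_sqrt hσ1.1.le] using hhσ1⟩
      refine ((hopen.measure_pos volume hne).trans_le ?_).ne'
      rw [Measure.restrict_apply' measurableSet_Ioc]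
      refine measure_mono fun r hr => ⟨?_, Ioo_subset_Ioc_self hr.1⟩
      obtain ⟨hr, hkr⟩ := hr
      have hFr : 0 < Fnl f r0 (r ^ 2) :=
        hF _ ⟨sq_nonneg r, pow_lt_pow_left₀ hr.2 hr.1.le two_ne_zero⟩
      have hr0' := hr.1
      have hsub : r ^ 2 - r0 ^ 2 ≠ 0 :=
        (sub_neg.2 (pow_lt_pow_left₀ hr.2 hr.1.le two_ne_zero)).ne
      rw [mem_ofPred_eq, ← sub_pos, vkIntegrand_sub_vkIntegrand _ _ hFr.le]
      refine mul_pos (by positivity) (sub_pos.2 (Real.sqrt_lt_sqrt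
        (hN κ₁ hκ₁ r (Ioo_subset_Ioc_self hr)).le ?_))
      have : deriv h (r ^ 2) ≠ 0 := hkr
      gcongr
  refine ⟨hκneg, fun κ _ => hint κ, hmono, ?_⟩
  have hgap : 0 < Q 1 - Q 0 :=
    sub_pos.2 (hmono hκneg (hκneg.trans one_pos) one_pos)
  have hlim : Tendsto (fun κ => √κ * (Q 1 - Q 0) + Q 0) atTop atTop :=
    tendsto_atTop_add_const_right _ _ (Real.tendsto_sqrt_atTop.atTop_mul_const hgap)
  refine tendsto_atTop_mono' _ ?_ hlim
  filter_upwards [eventually_ge_atTop 1] with κ hκ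
  rw [← le_sub_iff_add_le]
  simp only [hQ', add_sub_add_left_eq_sub]
  rw [← intervalIntegral.integral_sub (hintv _) (hintv _),
    ← intervalIntegral.integral_sub (hintv _) (hintv _), ← intervalIntegral.integral_const_mul]
  refine intervalIntegral.integral_mono_on_of_le_Ioo hr0.le
    (((hintv _).sub (hintv _)).const_mul _) ((hintv _).sub (hintv _)) fun r hr => ?_
  have hFr := hFnn r (Ioo_subset_Ioc_self hr)
  rw [vkIntegrand_sub_vkIntegrand _ _ hFr, vkIntegrand_sub_vkIntegrand _ _ hFr, mul_left_comm]
  refine mul_le_mul_of_nonneg_left ?_ (by positivity)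
  have key := mul_sqrt_one_add_sub_one_le
    (a := 2 * r ^ 2 * (deriv h (r ^ 2)) ^ 2) (by positivity) (Real.one_le_sqrt.2 hκ)
  rw [Real.sq_sqrt (zero_le_one.trans hκ), show κ * (2 * r ^ 2 * (deriv h (r ^ 2)) ^ 2) =
    2 * κ * r ^ 2 * (deriv h (r ^ 2)) ^ 2 by ring] at key
  simpa only [mul_one, mul_zero, zero_mul, add_zero, Real.sqrt_one] using key

end
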